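/- Let X be a complex Hilbert space, A and A_n bounded linear operators on X with ‖A‖ ≤ 1 and ‖A_n‖ ≤ 1, and let P be an orthogonal projection onto a closed subspace of X. Let ρ, δ, γ > 0, n ≥ 1 and k ≥ 1 integers, x† ∈ X with ‖x†‖ ≤ ρ, f = A x†, and f_δ ∈ X with ‖f − f_δ‖ ≤ δ. Let κ₀ ≥ 1, κ₂ > 0, and let r be a real polynomial of degree at most k with r(0) = 1 satisfying |r(λ)| ≤ κ₀ and |λ·r(λ)| ≤ κ₂/(k+1)² for all λ ∈ [0,1]; let g be the polynomial with r(λ) = 1 − λ·g(λ). Assume ‖A*A − A_n*A_n‖ ≤ γδ/(2kρ), ‖AA* − A_nA_n*‖ ≤ γδ/(2kρ), and ‖PA − A‖ ≤ γδ/(2kρn). Then, with x_k = g(A*A)A* f and x_{n,k}^δ = g(A_n*A_n)A_n* f_δ, one has ‖A x_k − f‖ ≤ ‖A_n x_{n,k}^δ − P f_δ‖ + c₁·δ, where c₁ = κ₀ + 2 + (√(κ₀(κ₀/2 + κ₂)) + 1/(2n))·γ. -/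

import Mathlib

section Schur

open Polynomial Polynomial.Chebyshev Real

/-- The `j`-th zero of the `n`-th Chebyshev polynomial of the first kind, as an angle. -/
noncomputable def chebyshevAngle (n j : ℕ) : ℝ := (2 * j + 1) * π / (2 * n)

lemma chebyshevAngle_pos {n j : ℕ} (hj : j < n) : 0 < chebyshevAngle n j := by
  have : 0 < n := by omega
  unfold chebyshevAngle
  positivity

lemma chebyshevAngle_lt_pi {n j : ℕ} (hj : j < n) : chebyshevAngle n j < π := by
  have hn : (0 : ℝ) < n := by exact_mod_cast (show 0 < n by omega)
  have hj' : (j : ℝ) + 1 ≤ n := by exact_mod_cast hj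
  unfold chebyshevAngle
  rw [div_lt_iff₀ (by positivity)]
  nlinarith [pi_pos]

lemma chebyshevAngle_lt {n i j : ℕ} (hj : j < n) (hij : i < j) :
    chebyshevAngle n i < chebyshevAngle n j := by
  have hn : (0 : ℝ) < n := by exact_mod_cast (show 0 < n by omega)
  have hij' : (i : ℝ) < j := by exact_mod_cast hij
  unfold chebyshevAngle
  gcongr

lemma cos_chebyshevAngle_lt {n i j : ℕ} (hj : j < n) (hij : i < j) :
    cos (chebyshevAngle n j) < cos (chebyshevAngle n i) :=
  cos_lt_cos_of_nonneg_of_le_pi (chebyshevAngle_pos (hij.trans hj)).le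
    (chebyshevAngle_lt_pi hj).le (chebyshevAngle_lt hj hij)

lemma sin_chebyshevAngle_pos {n j : ℕ} (hj : j < n) : 0 < sin (chebyshevAngle n j) :=
  sin_pos_of_pos_of_lt_pi (chebyshevAngle_pos hj) (chebyshevAngle_lt_pi hj)

lemma injOn_cos_chebyshevAngle (n : ℕ) :
    Set.InjOn (fun j => cos (chebyshevAngle n j)) (Finset.range n) := by
  intro i hi j hj h
  simp only [Finset.coe_range, Set.mem_Iio] at hi hj
  rcases lt_trichotomy i j with hij | hij | hij
  · exact absurd h (cos_chebyshevAngle_lt hj hij).ne'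
  · exact hij
  · exact absurd h (cos_chebyshevAngle_lt hi hij).ne

lemma eval_U_cos_chebyshevAngle {n j : ℕ} (hj : j < n) :
    (U ℝ (n - 1 : ℤ)).eval (cos (chebyshevAngle n j)) * sin (chebyshevAngle n j) = (-1) ^ j := by
  have hn : (n : ℝ) ≠ 0 := by exact_mod_cast (show n ≠ 0 by omega)
  rw [U_real_cos]
  have : (((n - 1 : ℤ) : ℝ) + 1) * chebyshevAngle n j = π / 2 + j * π := by
    unfold chebyshevAngle
    push_cast
    field_simp
    ring
  rw [this, sin_add_nat_mul_pi]
  simp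

lemma negOnePow_mul_eval_one_basis_nonneg {n j : ℕ} (hj : j < n) :
    0 ≤ (-1) ^ j * (Lagrange.basis (Finset.range n)
      (fun j => cos (chebyshevAngle n j)) j).eval 1 := by
  have hfac : ∀ i, (Lagrange.basisDivisor (cos (chebyshevAngle n j))
      (cos (chebyshevAngle n i))).eval 1 =
      (cos (chebyshevAngle n j) - cos (chebyshevAngle n i))⁻¹ *
        (1 - cos (chebyshevAngle n i)) := by
    intro i
    simp [Lagrange.basisDivisor]
  rw [Lagrange.basis, eval_prod]
  simp_rw [hfac]
  have union : (Finset.range n).erase j = (Finset.range j) ∪ Finset.Ioo j n := by grind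
  have disjoint : Disjoint (Finset.range j) (Finset.Ioo j n) := by
    grind [Finset.disjoint_iff_ne]
  rw [union, Finset.prod_union disjoint, ← mul_assoc]
  refine mul_nonneg ?_ (Finset.prod_nonneg fun i hi => ?_)
  · have : (-1 : ℝ) ^ j = ∏ _i ∈ Finset.range j, (-1 : ℝ) := by simp
    rw [this, ← Finset.prod_mul_distrib]
    refine Finset.prod_nonneg fun i hi => ?_
    have h := cos_chebyshevAngle_lt hj (Finset.mem_range.mp hi)
    rw [← mul_assoc, neg_one_mul, ← inv_neg, neg_sub]
    exact mul_nonneg (inv_nonneg.mpr (sub_nonneg.mpr h.le)) (sub_nonneg.mpr (cos_le_one _))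
  · have h := cos_chebyshevAngle_lt (Finset.mem_Ioo.mp hi).2 (Finset.mem_Ioo.mp hi).1
    exact mul_nonneg (inv_nonneg.mpr (sub_nonneg.mpr h.le)) (sub_nonneg.mpr (cos_le_one _))

/-- Schur's inequality at the endpoint: a real polynomial of degree less than `n` which is bounded
by `M / √(1 - s ^ 2)` on `(-1, 1)` is bounded by `n * M` at `1`. -/
theorem Polynomial.abs_eval_one_le_of_sqrt_mul_abs_eval_le {n : ℕ} {q : ℝ[X]} {M : ℝ}
    (hq : q.degree < n)
    (h : ∀ s ∈ Set.Ioo (-1 : ℝ) 1, √(1 - s ^ 2) * |q.eval s| ≤ M) :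
    |q.eval 1| ≤ n * M := by
  set v : ℕ → ℝ := fun j => cos (chebyshevAngle n j) with hv
  have interp : ∀ p : ℝ[X], p.degree < n → p.eval 1 =
      ∑ j ∈ Finset.range n, p.eval (v j) * (Lagrange.basis (Finset.range n) v j).eval 1 := by
    intro p hp
    have := Lagrange.eq_interpolate (f := p) (injOn_cos_chebyshevAngle n) (by simpa using hp)
    conv_lhs => rw [this]
    simp [Lagrange.interpolate_apply, eval_finsetSum, hv]
  rcases Nat.eq_zero_or_pos n with rfl | hn
  · simp [interp q hq]
  have hU : (U ℝ (n - 1 : ℤ)).degree < n := by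
    obtain ⟨m, rfl⟩ := Nat.exists_eq_succ_of_ne_zero hn.ne'
    rw [show ((m.succ : ℕ) - 1 : ℤ) = (m : ℤ) by simp, degree_U_natCast]
    exact_mod_cast Nat.lt_succ_self m
  have hU1 := interp _ hU
  rw [U_eval_one] at hU1
  push_cast at hU1
  rw [sub_add_cancel] at hU1
  rw [interp q hq, hU1, Finset.sum_mul]
  refine (Finset.abs_sum_le_sum_abs _ _).trans (Finset.sum_le_sum fun j hj => ?_)
  have hj := Finset.mem_range.mp hj
  have hb := negOnePow_mul_eval_one_basis_nonneg hj
  have hs := sin_chebyshevAngle_pos hj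
  have hUj := eval_U_cos_chebyshevAngle hj
  set b := (Lagrange.basis (Finset.range n) v j).eval 1
  have hlt1 : v j < 1 := by
    have := cos_lt_cos_of_nonneg_of_le_pi le_rfl (chebyshevAngle_lt_pi hj).le
      (chebyshevAngle_pos hj)
    rwa [cos_zero] at this
  have hgt1 : -1 < v j := by
    have := cos_lt_cos_of_nonneg_of_le_pi (chebyshevAngle_pos hj).le le_rfl
      (chebyshevAngle_lt_pi hj)
    rwa [cos_pi] at this
  have hbound := h (v j) ⟨hgt1, hlt1⟩
  have hsin : √(1 - v j ^ 2) = sin (chebyshevAngle n j) := by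
    rw [hv, ← sin_sq, sqrt_sq hs.le]
  rw [hsin] at hbound
  have habs : |b| = (-1) ^ j * b := by
    rw [← abs_of_nonneg hb, abs_mul]
    simp
  have hU' : (U ℝ (n - 1 : ℤ)).eval (v j) = (-1) ^ j / sin (chebyshevAngle n j) := by
    rw [eq_div_iff hs.ne', hUj]
  rw [abs_mul, hU', habs]
  calc |q.eval (v j)| * ((-1) ^ j * b)
      ≤ (M / sin (chebyshevAngle n j)) * ((-1) ^ j * b) := by
        refine mul_le_mul_of_nonneg_right ?_ hb
        rw [le_div_iff₀ hs]
        linarith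
    _ = _ := by ring

end Schur

section NormedAlgebra

open Polynomial

variable {E : Type*} [NormedRing E] [NormedAlgebra ℝ E]

/-- A vector-valued function of a real variable is polynomial of degree less than `n` when all its
compositions with linear functionals are. -/
def IsPolynomialOfDegreeLT (n : ℕ) (F : ℝ → E) : Prop :=
  ∀ φ : E →ₗ[ℝ] ℝ, ∃ q : ℝ[X], q.degree < n ∧ ∀ t, φ (F t) = q.eval t

namespace IsPolynomialOfDegreeLT

variable {n m : ℕ} {F G : ℝ → E}

lemma mono (hF : IsPolynomialOfDegreeLT n F) (h : n ≤ m) : IsPolynomialOfDegreeLT m F := by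
  intro φ
  obtain ⟨q, hq, hqF⟩ := hF φ
  exact ⟨q, hq.trans_le (by exact_mod_cast h), hqF⟩

lemma zero : IsPolynomialOfDegreeLT n (fun _ => (0 : E)) :=
  fun _ => ⟨0, by simp, by simp⟩

lemma const (x : E) : IsPolynomialOfDegreeLT 1 (fun _ => x) :=
  fun φ => ⟨C (φ x), degree_C_le.trans_lt (by norm_num), by simp⟩

lemma add (hF : IsPolynomialOfDegreeLT n F) (hG : IsPolynomialOfDegreeLT n G) :
    IsPolynomialOfDegreeLT n (fun t => F t + G t) := by
  intro φ
  obtain ⟨q, hq, hqF⟩ := hF φ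
  obtain ⟨r, hr, hrG⟩ := hG φ
  exact ⟨q + r, (degree_add_le _ _).trans_lt (max_lt hq hr), by simp [hqF, hrG]⟩

lemma const_smul (a : ℝ) (hF : IsPolynomialOfDegreeLT n F) :
    IsPolynomialOfDegreeLT n (fun t => a • F t) := by
  intro φ
  obtain ⟨q, hq, hqF⟩ := hF φ
  exact ⟨a • q, (degree_smul_le _ _).trans_lt hq, by simp [hqF]⟩

lemma sum {ι : Type*} {s : Finset ι} {H : ι → ℝ → E}
    (hH : ∀ i ∈ s, IsPolynomialOfDegreeLT n (H i)) :
    IsPolynomialOfDegreeLT n (fun t => ∑ i ∈ s, H i t) := by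
  classical
  induction s using Finset.induction_on with
  | empty => simpa using zero
  | insert a s ha ih =>
    simp_rw [Finset.sum_insert ha]
    exact (hH a (by simp)).add (ih fun i hi => hH i (by simp [hi]))

lemma mul_const (x : E) (hF : IsPolynomialOfDegreeLT n F) :
    IsPolynomialOfDegreeLT n (fun t => F t * x) := by
  intro φ
  obtain ⟨q, hq, hqF⟩ := hF (φ ∘ₗ LinearMap.mulRight ℝ x)
  exact ⟨q, hq, by simpa using hqF⟩

lemma id_smul (hF : IsPolynomialOfDegreeLT n F) :
    IsPolynomialOfDegreeLT (n + 1) (fun t => t • F t) := by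
  intro φ
  obtain ⟨q, hq, hqF⟩ := hF φ
  refine ⟨X * q, ?_, by simp [hqF]⟩
  rcases eq_or_ne q 0 with rfl | hq0
  · simp only [mul_zero, degree_zero]
    exact WithBot.bot_lt_coe _
  · rw [degree_eq_natDegree hq0] at hq
    rw [degree_eq_natDegree (mul_ne_zero X_ne_zero hq0), natDegree_X_mul hq0]
    have : q.natDegree < n := by exact_mod_cast hq
    exact_mod_cast Nat.add_lt_add_right this 1

/-- Vector-valued form of Schur's inequality at the endpoint. -/
theorem norm_apply_one_le {M : ℝ} (hF : IsPolynomialOfDegreeLT n F)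
    (h : ∀ s ∈ Set.Ioo (-1 : ℝ) 1, √(1 - s ^ 2) * ‖F s‖ ≤ M) : ‖F 1‖ ≤ n * M := by
  obtain ⟨φ, hφ, hφF⟩ := exists_dual_vector'' ℝ (F 1)
  obtain ⟨q, hq, hqF⟩ := hF φ.toLinearMap
  have hqF' : ∀ t, q.eval t = φ (F t) := fun t => (hqF t).symm
  have := Polynomial.abs_eval_one_le_of_sqrt_mul_abs_eval_le hq (M := M) fun s hs => by
    refine le_trans ?_ (h s hs)
    rw [hqF', ← Real.norm_eq_abs]
    gcongr
    exact (φ.le_of_opNorm_le hφ _).trans_eq (one_mul _)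
  rw [hqF', hφF] at this
  simpa using this

end IsPolynomialOfDegreeLT

/-- The derivative of `x ↦ x ^ n` in the direction `y`. -/
def powDeriv (x y : E) : ℕ → E
  | 0 => 0
  | n + 1 => powDeriv x y n * x + x ^ n * y

lemma powDeriv_smul_right (x y : E) (a : ℝ) (n : ℕ) :
    powDeriv x (a • y) n = a • powDeriv x y n := by
  induction n with
  | zero => simp [powDeriv]
  | succ n ih => simp [powDeriv, ih]

lemma hasDerivAt_add_smul_pow (x y : E) (n : ℕ) (t : ℝ) :
    HasDerivAt (fun t : ℝ => (x + t • y) ^ n) (powDeriv (x + t • y) y n) t := by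
  induction n with
  | zero => simpa [powDeriv] using hasDerivAt_const t (1 : E)
  | succ n ih =>
    have h : HasDerivAt (fun t : ℝ => x + t • y) y t := by
      simpa using ((hasDerivAt_id t).smul_const y).const_add x
    simpa only [pow_succ, powDeriv] using ih.fun_mul h

lemma isPolynomialOfDegreeLT_powDeriv (x y : E) (n : ℕ) :
    IsPolynomialOfDegreeLT n (fun t => powDeriv (t • x) y n) := by
  have hpow : ∀ n : ℕ, IsPolynomialOfDegreeLT (n + 1) (fun t => (t • x) ^ n) := by
    intro n
    induction n with
    | zero => simpa using IsPolynomialOfDegreeLT.const (1 : E)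
    | succ n ih => simpa only [pow_succ, mul_smul_comm] using (ih.mul_const x).id_smul
  induction n with
  | zero => exact .zero
  | succ n ih =>
    simpa only [powDeriv, mul_smul_comm] using
      (ih.mul_const x).id_smul.add ((hpow n).mul_const y)

/-- The derivative of `x ↦ p(x)` in the direction `y`. -/
noncomputable def polyDeriv (p : ℝ[X]) (x y : E) : E :=
  ∑ i ∈ Finset.range (p.natDegree + 1), p.coeff i • powDeriv x y i

lemma polyDeriv_smul_right (p : ℝ[X]) (x y : E) (a : ℝ) :
    polyDeriv p x (a • y) = a • polyDeriv p x y := by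
  simp [polyDeriv, powDeriv_smul_right, Finset.smul_sum, smul_comm a]

lemma hasDerivAt_aeval_add_smul (p : ℝ[X]) (x y : E) (t : ℝ) :
    HasDerivAt (fun t : ℝ => aeval (x + t • y) p) (polyDeriv p (x + t • y) y) t := by
  simp only [aeval_eq_sum_range, polyDeriv]
  exact HasDerivAt.fun_sum fun i _ => (hasDerivAt_add_smul_pow x y i t).fun_const_smul _

lemma isPolynomialOfDegreeLT_polyDeriv (p : ℝ[X]) (x y : E) :
    IsPolynomialOfDegreeLT p.natDegree (fun t => polyDeriv p (t • x) y) :=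
  .sum fun i hi => ((isPolynomialOfDegreeLT_powDeriv x y i).mono
    (Nat.lt_succ_iff.mp (Finset.mem_range.mp hi))).const_smul _

/-- The pair `(u, v)` of polynomial functions of `c` such that `(c x + s z) ^ n = u + s v`
whenever `c ^ 2 + s ^ 2 = 1`. -/
def trigParts (x z : E) (c : ℝ) : ℕ → E × E
  | 0 => (1, 0)
  | n + 1 => (c • ((trigParts x z c n).1 * x) + (1 - c ^ 2) • ((trigParts x z c n).2 * z),
      c • ((trigParts x z c n).2 * x) + (trigParts x z c n).1 * z)

lemma smul_add_smul_pow (x z : E) {c s : ℝ} (h : s ^ 2 = 1 - c ^ 2) (n : ℕ) :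
    (c • x + s • z) ^ n = (trigParts x z c n).1 + s • (trigParts x z c n).2 := by
  induction n with
  | zero => simp [trigParts]
  | succ n ih =>
    rw [pow_succ, ih, trigParts, ← h]
    simp only [mul_add, add_mul, smul_mul_assoc, mul_smul_comm]
    module

lemma isPolynomialOfDegreeLT_trigParts (x z : E) (n : ℕ) :
    IsPolynomialOfDegreeLT (n + 1) (fun c => (trigParts x z c n).1) ∧
      IsPolynomialOfDegreeLT n (fun c => (trigParts x z c n).2) := by
  induction n with
  | zero => exact ⟨.const 1, .zero⟩
  | succ n ih =>
    obtain ⟨h₁, h₂⟩ := ih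
    refine ⟨?_, (h₂.mul_const x).id_smul.add (h₁.mul_const z)⟩
    have h₃ := (h₂.mul_const z).id_smul.id_smul.const_smul (-1)
    have h₄ := (h₂.mul_const z).mono (show n ≤ n + 1 + 1 by omega)
    convert ((h₁.mul_const x).id_smul.add (h₄.add h₃)) using 2 with c
    simp only [trigParts]
    module

lemma trigParts_one (x z : E) (n : ℕ) : trigParts x z 1 n = (x ^ n, powDeriv x z n) := by
  induction n with
  | zero => simp [trigParts, powDeriv]
  | succ n ih => simp [trigParts, powDeriv, ih, pow_succ]

variable {p : ℝ[X]} {V : Submodule ℝ E} {M : ℝ}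

/-- Bernstein's inequality for the directional derivative of a polynomial on a normed algebra. -/
theorem sqrt_mul_norm_polyDeriv_le
    (hM : ∀ z ∈ V, ‖z‖ ≤ 1 → ‖aeval z p‖ ≤ M) {x y : E} (hxV : x ∈ V) (hyV : y ∈ V)
    {τ : ℝ} (hτ : |τ| ≤ 1) (hx : ‖x‖ ≤ |τ|) (hy : ‖y‖ ≤ 1) :
    √(1 - τ ^ 2) * ‖polyDeriv p x y‖ ≤ p.natDegree * M := by
  set σ := √(1 - τ ^ 2) with hσ
  have hσ0 : 0 ≤ σ := Real.sqrt_nonneg _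
  have hτσ : |τ| ^ 2 + σ ^ 2 = 1 := by
    rw [hσ, Real.sq_sqrt (by rw [← sq_abs]; nlinarith [abs_nonneg τ]), sq_abs]
    ring
  set z := σ • y with hz
  have hzV : z ∈ V := V.smul_mem _ hyV
  have hzn : ‖z‖ ≤ σ := by
    rw [hz, norm_smul, Real.norm_of_nonneg hσ0]
    exact mul_le_of_le_one_right hσ0 hy
  let O : ℝ → E := fun c =>
    ∑ i ∈ Finset.range (p.natDegree + 1), p.coeff i • (trigParts x z c i).2
  have hO : IsPolynomialOfDegreeLT p.natDegree O :=
    .sum fun i hi => ((isPolynomialOfDegreeLT_trigParts x z i).2.mono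
      (Nat.lt_succ_iff.mp (Finset.mem_range.mp hi))).const_smul _
  have hO1 : O 1 = σ • polyDeriv p x y := by
    rw [← polyDeriv_smul_right]
    simp [O, trigParts_one, polyDeriv, hz]
  have hunit : ∀ c s : ℝ, s ^ 2 = 1 - c ^ 2 → ‖aeval (c • x + s • z) p‖ ≤ M := by
    intro c s hcs
    refine hM _ (V.add_mem (V.smul_mem _ hxV) (V.smul_mem _ hzV)) ?_
    calc ‖c • x + s • z‖ ≤ |c| * |τ| + |s| * σ := by
          refine (norm_add_le _ _).trans ?_
          rw [norm_smul, norm_smul, Real.norm_eq_abs, Real.norm_eq_abs]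
          gcongr
      _ ≤ 1 := by
          nlinarith [sq_nonneg (|c| - |τ|), sq_nonneg (|s| - σ), sq_abs c, sq_abs s]
  have hbound : ∀ c ∈ Set.Ioo (-1 : ℝ) 1, √(1 - c ^ 2) * ‖O c‖ ≤ M := by
    intro c hc
    set s := √(1 - c ^ 2)
    have hs : s ^ 2 = 1 - c ^ 2 := Real.sq_sqrt (by nlinarith [hc.1, hc.2])
    have hdiff : aeval (c • x + s • z) p - aeval (c • x + (-s) • z) p = (2 : ℝ) • s • O c := by
      simp only [aeval_eq_sum_range, smul_add_smul_pow x z hs,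
        smul_add_smul_pow x z ((neg_sq s).trans hs), O, Finset.smul_sum]
      rw [← Finset.sum_sub_distrib]
      refine Finset.sum_congr rfl fun i _ => ?_
      module
    have hnorm : ‖(2 : ℝ) • s • O c‖ ≤ M + M := by
      rw [← hdiff]
      exact (norm_sub_le _ _).trans (add_le_add (hunit c s hs) (hunit c (-s) ((neg_sq s).trans hs)))
    rw [norm_smul, norm_smul, Real.norm_of_nonneg (Real.sqrt_nonneg _),
      Real.norm_of_nonneg zero_le_two] at hnorm
    linarith
  have := hO.norm_apply_one_le hbound
  rwa [hO1, norm_smul, Real.norm_of_nonneg hσ0] at this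

/-- Markov's inequality for the directional derivative of a polynomial on a normed algebra. -/
theorem norm_polyDeriv_le
    (hM : ∀ z ∈ V, ‖z‖ ≤ 1 → ‖aeval z p‖ ≤ M) {x y : E} (hxV : x ∈ V) (hyV : y ∈ V)
    (hx : ‖x‖ ≤ 1) : ‖polyDeriv p x y‖ ≤ p.natDegree ^ 2 * M * ‖y‖ := by
  have key : ∀ y ∈ V, ‖y‖ ≤ 1 → ‖polyDeriv p x y‖ ≤ p.natDegree ^ 2 * M := by
    intro y hyV hy
    have := (isPolynomialOfDegreeLT_polyDeriv p x y).norm_apply_one_le fun t ht =>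
      sqrt_mul_norm_polyDeriv_le hM (V.smul_mem t hxV) hyV
        (abs_le.mpr ⟨ht.1.le, ht.2.le⟩)
        (by rw [norm_smul, Real.norm_eq_abs]; exact mul_le_of_le_one_right (abs_nonneg t) hx) hy
    rwa [one_smul, ← mul_assoc, ← sq] at this
  rcases eq_or_ne y 0 with rfl | hy
  · have h0 : polyDeriv p x (0 : E) = 0 := by simpa using polyDeriv_smul_right p x (0 : E) 0
    simp [h0]
  have hy' : 0 < ‖y‖ := norm_pos_iff.mpr hy
  have := key (‖y‖⁻¹ • y) (V.smul_mem _ hyV) (by simp [norm_smul, hy'.ne'])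
  rw [polyDeriv_smul_right, norm_smul, norm_inv, norm_norm, inv_mul_le_iff₀ hy'] at this
  linarith

/-- A polynomial which is bounded on the unit ball of a subspace is Lipschitz there, with the
constant of Markov's inequality. -/
theorem norm_aeval_sub_aeval_le
    (hM : ∀ z ∈ V, ‖z‖ ≤ 1 → ‖aeval z p‖ ≤ M) {x y : E} (hxV : x ∈ V) (hyV : y ∈ V)
    (hx : ‖x‖ ≤ 1) (hy : ‖y‖ ≤ 1) :
    ‖aeval x p - aeval y p‖ ≤ p.natDegree ^ 2 * M * ‖x - y‖ := by
  have hd : x - y ∈ V := V.sub_mem hxV hyV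
  have := norm_image_sub_le_of_norm_deriv_le_segment_01'
    (f := fun t : ℝ => aeval (y + t • (x - y)) p)
    (fun t _ => (hasDerivAt_aeval_add_smul p y (x - y) t).hasDerivWithinAt)
    (fun t ht => norm_polyDeriv_le hM (V.add_mem hyV (V.smul_mem t hd)) hd (by
      have := (convex_closedBall (0 : E) 1).add_smul_sub_mem
        (mem_closedBall_zero_iff.mpr hy) (mem_closedBall_zero_iff.mpr hx) ⟨ht.1, ht.2.le⟩
      exact mem_closedBall_zero_iff.mp this))
  simpa using this

end NormedAlgebra

section CStarAlgebra

open Polynomial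

variable {E : Type*} [CStarAlgebra E]

lemma abs_le_norm_of_mem_spectrum_real {z : E} {x : ℝ} (hx : x ∈ spectrum ℝ z) : |x| ≤ ‖z‖ := by
  rcases subsingleton_or_nontrivial E with h | h
  · simp [spectrum.of_subsingleton] at hx
  · exact spectrum.norm_le_norm_of_mem hx

lemma norm_aeval_le_of_isSelfAdjoint {z : E} (hz : IsSelfAdjoint z) {p : ℝ[X]} {s : Set ℝ}
    {M : ℝ} (hs : spectrum ℝ z ⊆ s) (hM : 0 ≤ M) (hp : ∀ x ∈ s, |p.eval x| ≤ M) :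
    ‖aeval z p‖ ≤ M := by
  rw [← cfc_polynomial p z hz]
  exact norm_cfc_le hM fun x hx => hp x (hs hx)

lemma isSelfAdjoint_aeval {z : E} (hz : IsSelfAdjoint z) (p : ℝ[X]) :
    IsSelfAdjoint (aeval z p) := by
  rw [← cfc_polynomial p z hz]
  exact cfc_predicate _ _

lemma spectrum_mul_star_self_subset_Icc {a : E} (ha : ‖a‖ ≤ 1) :
    spectrum ℝ (a * star a) ⊆ Set.Icc 0 1 := by
  intro x hx
  have h0 : 0 ≤ x := by
    have := spectrum_star_mul_self_nonneg (b := star a) x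
    rw [star_star] at this
    exact this hx
  refine ⟨h0, (le_abs_self x).trans ((abs_le_norm_of_mem_spectrum_real hx).trans ?_)⟩
  rw [CStarRing.norm_self_mul_star]
  exact mul_le_one₀ ha (norm_nonneg _) ha

/-- Markov's inequality on `[0, 1]` for the functional calculus: a real polynomial bounded by `M`
on `[0, 1]` is Lipschitz with constant `2 * natDegree ^ 2 * M` on the self-adjoint elements with
spectrum in `[0, 1]`. -/
theorem norm_aeval_sub_aeval_le_of_spectrum_subset {p : ℝ[X]} {M : ℝ}
    (hp : ∀ x ∈ Set.Icc (0 : ℝ) 1, |p.eval x| ≤ M) {a b : E}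
    (ha : IsSelfAdjoint a) (hb : IsSelfAdjoint b)
    (ha' : spectrum ℝ a ⊆ Set.Icc 0 1) (hb' : spectrum ℝ b ⊆ Set.Icc 0 1) :
    ‖aeval a p - aeval b p‖ ≤ 2 * p.natDegree ^ 2 * M * ‖a - b‖ := by
  have hM : 0 ≤ M := (abs_nonneg _).trans (hp 0 (by simp))
  set l : ℝ[X] := C 2 * X - C 1 with hl
  set l' : ℝ[X] := C 2⁻¹ * X + C 2⁻¹ with hl'
  have hinv : ∀ c : E, aeval (aeval c l) (p.comp l') = aeval c p := by
    intro c
    rw [← aeval_comp, comp_assoc]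
    congr 1
    have : l'.comp l = X := by
      simp only [hl, hl', add_comp, mul_comp, C_comp, X_comp, mul_sub, ← mul_assoc, ← C_mul]
      norm_num
    rw [this, comp_X]
  have hdeg : (p.comp l').natDegree = p.natDegree := by
    rw [natDegree_comp, natDegree_linear (by norm_num), mul_one]
  have hnorm : ∀ c : E, IsSelfAdjoint c → spectrum ℝ c ⊆ Set.Icc 0 1 → ‖aeval c l‖ ≤ 1 := by
    intro c hc hc'
    refine norm_aeval_le_of_isSelfAdjoint hc hc' zero_le_one fun x hx => ?_
    simp only [hl, eval_sub, eval_mul, eval_C, eval_X]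
    rw [abs_le]
    constructor <;> linarith [hx.1, hx.2]
  have hball : ∀ z ∈ selfAdjoint.submodule ℝ E, ‖z‖ ≤ 1 → ‖aeval z (p.comp l')‖ ≤ M := by
    intro z hz hz1
    refine norm_aeval_le_of_isSelfAdjoint (s := Set.Icc (-1) 1) hz (fun x hx => ?_) hM
      fun x hx => ?_
    · exact abs_le.mp ((abs_le_norm_of_mem_spectrum_real hx).trans hz1)
    · rw [eval_comp]
      apply hp
      simp only [hl', eval_add, eval_mul, eval_C, eval_X]
      constructor <;> linarith [hx.1, hx.2]
  have := norm_aeval_sub_aeval_le hball (isSelfAdjoint_aeval ha l) (isSelfAdjoint_aeval hb l)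
    (hnorm a ha ha') (hnorm b hb hb')
  rw [hinv, hinv, hdeg] at this
  have hsub : aeval a l - aeval b l = (2 : ℝ) • (a - b) := by
    simp only [hl, map_sub, map_mul, aeval_C, aeval_X, map_one, ← Algebra.smul_def]
    module
  rw [hsub, norm_smul, Real.norm_of_nonneg zero_le_two] at this
  linarith

lemma mul_aeval_star_mul_self (a : E) (p : ℝ[X]) :
    a * aeval (star a * a) p = aeval (a * star a) p * a := by
  have h : SemiconjBy a (star a * a) (a * star a) := by
    simp [SemiconjBy, mul_assoc]
  rw [aeval_eq_sum_range, aeval_eq_sum_range, Finset.mul_sum, Finset.sum_mul]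
  refine Finset.sum_congr rfl fun i _ => ?_
  rw [mul_smul_comm, smul_mul_assoc, (h.pow_right i).eq]

/-- The difference of the residual polynomials of two positive contractions, applied to the range
of the corresponding operator. -/
theorem norm_aeval_sub_aeval_mul_le {a b : E} (ha : ‖a‖ ≤ 1) (hb : ‖b‖ ≤ 1) {r : ℝ[X]} {k : ℕ}
    (hdeg : r.natDegree ≤ k) {κ₀ κ₂ ε : ℝ}
    (hr : ∀ x ∈ Set.Icc (0 : ℝ) 1, |r.eval x| ≤ κ₀)
    (hXr : ∀ x ∈ Set.Icc (0 : ℝ) 1, |x * r.eval x| ≤ κ₂ / ((k : ℝ) + 1) ^ 2)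
    (hab : ‖a * star a - b * star b‖ ≤ ε) :
    ‖(aeval (a * star a) r - aeval (b * star b) r) * a‖ ≤
      2 * k * ε * √(κ₀ * (κ₀ / 2 + κ₂)) := by
  have hS := IsSelfAdjoint.mul_star_self a
  have hT := IsSelfAdjoint.mul_star_self b
  have hS' := spectrum_mul_star_self_subset_Icc ha
  have hT' := spectrum_mul_star_self_subset_Icc hb
  set S := a * star a with hSdef
  set T := b * star b
  set R := aeval S r - aeval T r with hR
  have hκ₀ : 0 ≤ κ₀ := (abs_nonneg _).trans (hr 0 (by simp))
  have hε : 0 ≤ ε := (norm_nonneg _).trans hab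
  have hq : 0 ≤ κ₂ / ((k : ℝ) + 1) ^ 2 := (abs_nonneg _).trans (hXr 0 (by simp))
  have hκ₂ : 0 ≤ κ₂ := by
    by_contra! h
    exact absurd hq (not_le.mpr (div_neg_of_neg_of_pos h (by positivity)))
  have hRsa : star R = R :=
    ((isSelfAdjoint_aeval hS r).sub (isSelfAdjoint_aeval hT r)).star_eq
  have hR1 : ‖R‖ ≤ 2 * k ^ 2 * κ₀ * ε := by
    refine (norm_aeval_sub_aeval_le_of_spectrum_subset hr hS hT hS' hT').trans ?_
    gcongr
  have hX : ‖aeval S (r * X) - aeval T (r * X)‖ ≤ 2 * κ₂ * ε := by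
    have h := norm_aeval_sub_aeval_le_of_spectrum_subset (p := r * X)
      (by simpa [mul_comm] using hXr) hS hT hS' hT'
    have hd : ((r * X).natDegree : ℝ) ≤ k + 1 := by
      have : (r * X).natDegree ≤ k + 1 :=
        natDegree_mul_le.trans (add_le_add hdeg natDegree_X_le)
      exact_mod_cast this
    calc _ ≤ 2 * ((k : ℝ) + 1) ^ 2 * (κ₂ / ((k : ℝ) + 1) ^ 2) * ε := by
          refine h.trans ?_
          gcongr
      _ = 2 * κ₂ * ε := by field_simp
  have hTr : ‖aeval T r‖ ≤ κ₀ := norm_aeval_le_of_isSelfAdjoint hT hT' hκ₀ hr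
  have hRS : ‖R * S‖ ≤ 2 * κ₂ * ε + κ₀ * ε := by
    have : R * S = (aeval S (r * X) - aeval T (r * X)) - aeval T r * (S - T) := by
      simp only [hR, map_mul, aeval_X]
      noncomm_ring
    rw [this]
    refine (norm_sub_le _ _).trans (add_le_add hX ((norm_mul_le _ _).trans ?_))
    gcongr
  have hsq : ‖R * a‖ ^ 2 ≤ (2 * k * ε) ^ 2 * (κ₀ * (κ₀ / 2 + κ₂)) := by
    calc ‖R * a‖ ^ 2 = ‖(R * S) * R‖ := by
          rw [sq, ← CStarRing.norm_self_mul_star, star_mul, hRsa, hSdef]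
          simp only [mul_assoc]
      _ ≤ (2 * κ₂ * ε + κ₀ * ε) * (2 * k ^ 2 * κ₀ * ε) := by
          refine (norm_mul_le _ _).trans ?_
          gcongr
      _ = _ := by ring
  rw [← Real.sqrt_sq (show 0 ≤ 2 * k * ε by positivity), ← Real.sqrt_mul (by positivity)]
  exact Real.le_sqrt_of_sq_le hsq

end CStarAlgebra

open ContinuousLinearMap in
/-- The residual of a polynomial regularization is given by the residual polynomial. -/
lemma apply_aeval_adjoint_eq_sub {X : Type*} [NormedAddCommGroup X] [InnerProductSpace ℂ X]
    [CompleteSpace X] (A : X →L[ℂ] X) {r g : Polynomial ℝ}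
    (hrg : ∀ x : ℝ, r.eval x = 1 - x * g.eval x) (f : X) :
    A ((Polynomial.aeval (adjoint A * A) (g.map (algebraMap ℝ ℂ))) (adjoint A f)) =
      f - Polynomial.aeval (A * star A) r f := by
  have hr : r = 1 - g * Polynomial.X := Polynomial.funext fun x => by simp [hrg, mul_comm]
  have h := congrArg (fun B : X →L[ℂ] X => B (star A f)) (mul_aeval_star_mul_self A g)
  rw [Polynomial.aeval_map_algebraMap, hr]
  simp only [star_eq_adjoint] at h ⊢
  simpa using h

open ContinuousLinearMap in
theorem stmt_9 {X : Type*} [NormedAddCommGroup X] [InnerProductSpace ℂ X] [CompleteSpace X]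
    (A An P : X →L[ℂ] X) (hA : ‖A‖ ≤ 1) (hAn : ‖An‖ ≤ 1)
    (hPsa : IsSelfAdjoint P) (hPidem : IsIdempotentElem P)
    (ρ δ γ : ℝ) (hρ : 0 < ρ) (hδ : 0 < δ) (hγ : 0 < γ)
    (n k : ℕ) (hn : 1 ≤ n) (hk : 1 ≤ k)
    (xdag : X) (hxdag : ‖xdag‖ ≤ ρ)
    (f : X) (hf : f = A xdag)
    (fδ : X) (hfδ : ‖f - fδ‖ ≤ δ)
    (κ₀ κ₂ : ℝ) (hκ₀ : 1 ≤ κ₀) (hκ₂ : 0 < κ₂)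
    (r g : Polynomial ℝ) (hdeg : r.natDegree ≤ k) (hr0 : r.eval 0 = 1)
    (hrg : ∀ x : ℝ, r.eval x = 1 - x * g.eval x)
    (hi : ∀ x ∈ Set.Icc (0:ℝ) 1, |r.eval x| ≤ κ₀)
    (hii : ∀ x ∈ Set.Icc (0:ℝ) 1, |x * r.eval x| ≤ κ₂ / ((k : ℝ) + 1) ^ 2)
    (hd1 : ‖adjoint A * A - adjoint An * An‖ ≤ γ * δ / (2 * (k : ℝ) * ρ))
    (hd2 : ‖A * adjoint A - An * adjoint An‖ ≤ γ * δ / (2 * (k : ℝ) * ρ))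
    (hd3 : ‖P * A - A‖ ≤ γ * δ / (2 * (k : ℝ) * ρ * (n : ℝ))) :
    ‖A ((Polynomial.aeval (adjoint A * A) (g.map (algebraMap ℝ ℂ))) (adjoint A f)) - f‖ ≤
      ‖An ((Polynomial.aeval (adjoint An * An) (g.map (algebraMap ℝ ℂ))) (adjoint An fδ)) - P fδ‖ +
        (κ₀ + 2 + (Real.sqrt (κ₀ * (κ₀ / 2 + κ₂)) + 1 / (2 * (n : ℝ))) * γ) * δ := by
  have hk0 : (0 : ℝ) < k := by exact_mod_cast hk
  have hk1 : (1 : ℝ) ≤ k := by exact_mod_cast hk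
  have hn0 : (0 : ℝ) < n := by exact_mod_cast hn
  have hP : ‖P‖ ≤ 1 := (IsStarProjection.mk hPidem hPsa).norm_le
  rw [apply_aeval_adjoint_eq_sub A hrg, apply_aeval_adjoint_eq_sub An hrg]
  set S := Polynomial.aeval (A * star A) r
  set T := Polynomial.aeval (An * star An) r
  have hT : ‖T‖ ≤ κ₀ := norm_aeval_le_of_isSelfAdjoint (IsSelfAdjoint.mul_star_self An)
    (spectrum_mul_star_self_subset_Icc hAn) (by linarith) hi
  have h1 : ‖((S - T) * A) xdag‖ ≤ √(κ₀ * (κ₀ / 2 + κ₂)) * γ * δ := by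
    have := norm_aeval_sub_aeval_mul_le hA hAn hdeg hi hii hd2
    calc _ ≤ (2 * k * (γ * δ / (2 * k * ρ)) * √(κ₀ * (κ₀ / 2 + κ₂))) * ρ :=
          le_of_opNorm_le_of_le _ this hxdag
      _ = _ := by field_simp
  have h2 : ‖T (f - fδ)‖ ≤ κ₀ * δ := le_of_opNorm_le_of_le _ hT hfδ
  have h3 : ‖P (f - fδ)‖ ≤ 1 * δ := le_of_opNorm_le_of_le _ hP hfδ
  have h4 : ‖(P * A - A) xdag‖ ≤ 1 / (2 * n) * γ * δ := by
    calc _ ≤ γ * δ / (2 * k * ρ * n) * ρ := le_of_opNorm_le_of_le _ hd3 hxdag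
      _ = γ * δ / (2 * n) / k := by field_simp
      _ ≤ γ * δ / (2 * n) := div_le_self (by positivity) hk1
      _ = _ := by ring
  have hsplit : f - S f - f = (fδ - T fδ - P fδ) - ((S - T) * A) xdag - T (f - fδ)
      - P (f - fδ) + (P * A - A) xdag + (f - fδ) := by
    simp only [sub_apply, mul_def, comp_apply, map_sub, ← hf]
    abel
  rw [hsplit]
  refine (norm_add_le_of_le (norm_add_le_of_le (norm_sub_le_of_le (norm_sub_le_of_le
    (norm_sub_le_of_le le_rfl h1) h2) h3) h4) hfδ).trans (le_of_eq ?_)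
  ring
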